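/- For every integer n ≥ 1 and every d′ ∈ (0,1), lim_{d→1⁻} C(d)/(1−d) ≤ C_n(d′)/(1−d′). -/

import Mathlib

open scoped BigOperators

noncomputable section

/-- Output alphabet of the binary deletion channel with `n` input bits:
a length `k ≤ n` together with a binary string of that length. -/
abbrev DelOut (n : ℕ) := Σ k : Fin (n + 1), (Fin (k : ℕ) → Bool)

/-- The subsequence of `x` indexed by `S` (taken in increasing order),
as an element of `DelOut n`. -/
def restrictSub {n : ℕ} (x : Fin n → Bool) (S : Finset (Fin n)) : DelOut n :=
  ⟨⟨S.card, Nat.lt_succ_of_le (by simpa using Finset.card_le_univ S)⟩,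
   fun i => x (S.orderEmbOfFin rfl i)⟩

/-- Transition probability of the binary deletion channel `W_n^d`: each input bit is
deleted independently with probability `d`. -/
def delW {n : ℕ} (d : ℝ) (x : Fin n → Bool) (y : DelOut n) : ℝ :=
  ∑ S : Finset (Fin n),
    if restrictSub x S = y then (1 - d) ^ S.card * d ^ (n - S.card) else 0

/-- Transition probability of the exact deletion channel `W_{n,k}`, which keeps exactly `k`
of the `n` input bits, the kept positions being a uniformly random `k`-subset; `k`-subsets
are identified with strictly monotone maps `Fin k → Fin n`. -/
def exactW {n k : ℕ} (x : Fin n → Bool) (y : Fin k → Bool) : ℝ :=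
  ((Finset.univ.filter fun f : Fin k → Fin n => StrictMono f ∧ x ∘ f = y).card : ℝ) /
    (n.choose k : ℝ)

/-- `p` is a probability distribution on the finite alphabet `α`. -/
def IsDist {α : Type*} [Fintype α] (p : α → ℝ) : Prop :=
  (∀ a, 0 ≤ p a) ∧ ∑ a, p a = 1

/-- Base-2 mutual information `I(X;Y)` between the input `X ~ p` and the output `Y`
of the channel with transition matrix `W`. -/
def mutualInfo {α β : Type*} [Fintype α] [Fintype β] (p : α → ℝ) (W : α → β → ℝ) : ℝ :=
  ∑ x, ∑ y, p x * W x y * Real.logb 2 (W x y / ∑ x', p x' * W x' y)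

/-- `C_n(d) = (1/n) · sup_p I(X ; W_n^d(X))`. -/
def Cn (n : ℕ) (d : ℝ) : ℝ :=
  (1 / (n : ℝ)) * ⨆ p : {p : (Fin n → Bool) → ℝ // IsDist p}, mutualInfo p.1 (delW d)

/-- `C_{n,k} = (1/n) · sup_p I(X ; W_{n,k}(X))`. -/
def Cnk (n k : ℕ) : ℝ :=
  (1 / (n : ℝ)) * ⨆ p : {p : (Fin n → Bool) → ℝ // IsDist p},
    mutualInfo p.1 (exactW (n := n) (k := k))

/-- Capacity of the binary deletion channel: `C(d) = inf_{n ≥ 1} C_n(d)`. -/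
def C (d : ℝ) : ℝ := ⨅ n : {m : ℕ // 1 ≤ m}, Cn n d

open Finset

section LogSum

variable {ι G : Type*}

/-- Relative entropy in bits of finitely supported weights. -/
def relEntropy (μ ν : G →₀ ℝ) : ℝ :=
  ∑ y ∈ μ.support, μ y * Real.logb 2 (μ y / ν y)

lemma sum_mul_logb_le_sum_mul_logb (t : Finset ι) (a b : ι → ℝ) (B : ℝ)
    (ha : ∀ i ∈ t, 0 < a i) (hb : ∀ i ∈ t, 0 < b i) (hB : ∑ i ∈ t, b i ≤ B) :
    (∑ i ∈ t, a i) * Real.logb 2 ((∑ i ∈ t, a i) / B) ≤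
      ∑ i ∈ t, a i * Real.logb 2 (a i / b i) := by
  rcases t.eq_empty_or_nonempty with rfl | ht
  · simp
  have hlog : 0 < Real.log 2 := Real.log_pos one_lt_two
  set A := ∑ i ∈ t, a i with hA
  have hApos : 0 < A := sum_pos ha ht
  have hBpos : 0 < B := (sum_pos hb ht).trans_le hB
  have key : ∑ i ∈ t, (a i - b i * (A / B)) ≤
      ∑ i ∈ t, a i * (Real.log (a i / b i) - Real.log (A / B)) := by
    refine sum_le_sum fun i hi => ?_
    have h1 := ha i hi
    have h2 := hb i hi
    have h3 := Real.one_sub_inv_le_log_of_pos (x := (a i / b i) / (A / B)) (by positivity)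
    rw [Real.log_div (by positivity) (by positivity)] at h3
    calc a i - b i * (A / B) = a i * (1 - ((a i / b i) / (A / B))⁻¹) := by field_simp
      _ ≤ _ := mul_le_mul_of_nonneg_left h3 h1.le
  have h0 : 0 ≤ ∑ i ∈ t, (a i - b i * (A / B)) := by
    rw [sum_sub_distrib, ← sum_mul, ← hA, sub_nonneg]
    calc (∑ i ∈ t, b i) * (A / B) ≤ B * (A / B) :=
          mul_le_mul_of_nonneg_right hB (by positivity)
      _ = A := by field_simp
  have h1 : A * Real.log (A / B) ≤ ∑ i ∈ t, a i * Real.log (a i / b i) := by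
    have := h0.trans key
    simp only [mul_sub, sum_sub_distrib, ← sum_mul, ← hA] at this
    linarith
  simp only [Real.logb, mul_div_assoc', ← sum_div]
  exact div_le_div_of_nonneg_right h1 hlog.le

lemma relEntropy_le_sum_mul_logb [DecidableEq G] (t : Finset ι) (f : ι → G) (a b : ι → ℝ)
    (μ ν : G →₀ ℝ) (ha : ∀ i ∈ t, 0 < a i) (hb : ∀ i ∈ t, 0 < b i)
    (hμ : ∀ y, μ y = ∑ i ∈ t with f i = y, a i)
    (hν : ∀ y, ∑ i ∈ t with f i = y, b i ≤ ν y) :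
    relEntropy μ ν ≤ ∑ i ∈ t, a i * Real.logb 2 (a i / b i) := by
  have hmaps : ∀ i ∈ t, f i ∈ μ.support := fun i hi => by
    rw [Finsupp.mem_support_iff, hμ]
    exact (sum_pos (fun j hj => ha j (mem_filter.1 hj).1) ⟨i, by simp [hi]⟩).ne'
  rw [← sum_fiberwise_of_maps_to hmaps]
  refine sum_le_sum fun y _ => ?_
  rw [hμ y]
  exact sum_mul_logb_le_sum_mul_logb _ a b _ (fun i hi => ha i (mem_filter.1 hi).1)
    (fun i hi => hb i (mem_filter.1 hi).1) (hν y)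

lemma relEntropy_nonneg (μ ν : G →₀ ℝ) (hμ : ∀ y, 0 ≤ μ y) (hν : ∀ y, 0 ≤ ν y)
    (hac : ∀ y, μ y ≠ 0 → ν y ≠ 0) (hμ1 : ∑ y ∈ μ.support, μ y = 1)
    (hν1 : ∑ y ∈ ν.support, ν y ≤ 1) : 0 ≤ relEntropy μ ν := by
  have hsub : μ.support ⊆ ν.support := fun y hy =>
    Finsupp.mem_support_iff.2 (hac y (Finsupp.mem_support_iff.1 hy))
  have := sum_mul_logb_le_sum_mul_logb μ.support μ ν 1
    (fun i hi => (hμ i).lt_of_ne' (Finsupp.mem_support_iff.1 hi))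
    (fun i hi => (hν i).lt_of_ne' (hac i (Finsupp.mem_support_iff.1 hi)))
    ((sum_le_sum_of_subset_of_nonneg hsub fun i _ _ => hν i).trans hν1)
  simpa [hμ1, relEntropy] using this

end LogSum

section DeletionAlgebra

open MonoidAlgebra

/-- Finitely supported weights on binary words, multiplied by concatenation. -/
abbrev WordAlgebra := MonoidAlgebra ℝ (FreeMonoid Bool)

/-- The output distribution of the deletion channel on an input word: each letter `b` is
replaced independently by the empty word with probability `d`. -/
def delDist (d : ℝ) : FreeMonoid Bool →* WordAlgebra :=
  FreeMonoid.lift fun b =>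
    d • (1 : WordAlgebra) + (1 - d) • MonoidAlgebra.of ℝ _ (FreeMonoid.of b)

lemma delDist_of (d : ℝ) (b : Bool) : delDist d (FreeMonoid.of b) =
    d • (1 : WordAlgebra) + (1 - d) • MonoidAlgebra.of ℝ _ (FreeMonoid.of b) :=
  FreeMonoid.lift_eval_of _ _

lemma coeff_delDist_of [DecidableEq (FreeMonoid Bool)] (d : ℝ) (b : Bool) (y : FreeMonoid Bool) :
    (delDist d (FreeMonoid.of b)).coeff y =
      (if 1 = y then d else 0) + if FreeMonoid.of b = y then 1 - d else 0 := by
  simp [delDist_of, one_def, Finsupp.single_apply]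
  split_ifs <;> simp

/-- Total mass, as an algebra homomorphism. -/
def mass : WordAlgebra →ₐ[ℝ] ℝ := MonoidAlgebra.lift ℝ ℝ (FreeMonoid Bool) 1

lemma mass_eq_sum (μ : WordAlgebra) : mass μ = ∑ y ∈ μ.coeff.support, μ.coeff y := by
  simp [mass, MonoidAlgebra.lift_apply, Finsupp.sum]

lemma mass_delDist (d : ℝ) (z : FreeMonoid Bool) : mass (delDist d z) = 1 := by
  have : (mass : WordAlgebra →* ℝ).comp (delDist d) = 1 := by
    ext b
    simp only [MonoidHom.coe_comp, MonoidHom.coe_coe, Function.comp_apply, delDist_of, mass,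
      map_add, map_smul, map_one, MonoidAlgebra.lift_of, MonoidHom.one_apply, smul_eq_mul]
    ring
  exact DFunLike.congr_fun this z

lemma lift_delDist_delDist (d e : ℝ) (z : FreeMonoid Bool) :
    MonoidAlgebra.lift ℝ WordAlgebra (FreeMonoid Bool) (delDist e) (delDist d z) =
      delDist (1 - (1 - d) * (1 - e)) z := by
  have : (MonoidAlgebra.lift ℝ WordAlgebra (FreeMonoid Bool) (delDist e) :
      WordAlgebra →* WordAlgebra).comp (delDist d) = delDist (1 - (1 - d) * (1 - e)) := by
    ext b : 1
    simp only [MonoidHom.coe_comp, MonoidHom.coe_coe, Function.comp_apply, delDist_of,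
      map_add, map_smul, map_one, MonoidAlgebra.lift_of]
    module
  exact DFunLike.congr_fun this z

lemma coeff_delDist_comp (d e : ℝ) (z y : FreeMonoid Bool) :
    (delDist (1 - (1 - d) * (1 - e)) z).coeff y =
      ∑ u ∈ (delDist d z).coeff.support, (delDist d z).coeff u * (delDist e u).coeff y := by
  rw [← lift_delDist_delDist, MonoidAlgebra.lift_apply, Finsupp.sum, coeff_sum,
    Finsupp.finsetSum_apply]
  simp

/-- The algebra homomorphism whose `ε`-part records the mean word length. -/
def lengthHom : WordAlgebra →ₐ[ℝ] DualNumber ℝ :=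
  MonoidAlgebra.lift ℝ (DualNumber ℝ) (FreeMonoid Bool)
    (FreeMonoid.lift fun _ => 1 + DualNumber.eps)

lemma one_add_smul_eps_pow (r : ℝ) (n : ℕ) :
    (1 + r • DualNumber.eps : DualNumber ℝ) ^ n = 1 + (n * r) • DualNumber.eps := by
  induction n with
  | zero => simp
  | succ n ih =>
    rw [pow_succ, ih]
    ext
    · simp
    · simp; ring

lemma freeMonoid_lift_const {M : Type*} [Monoid M] (m : M) (z : FreeMonoid Bool) :
    FreeMonoid.lift (fun _ : Bool => m) z = m ^ z.length := by
  induction z using FreeMonoid.inductionOn' with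
  | one => simp
  | of_mul b z ih => simp [ih, pow_add]

lemma sum_delDist_mul_length (d : ℝ) (z : FreeMonoid Bool) :
    ∑ u ∈ (delDist d z).coeff.support, (delDist d z).coeff u * (u.length : ℝ) =
      (1 - d) * z.length := by
  have h1 : (lengthHom : WordAlgebra →* DualNumber ℝ).comp (delDist d) =
      FreeMonoid.lift fun _ => 1 + (1 - d) • DualNumber.eps := by
    ext b
    all_goals
      simp only [MonoidHom.coe_comp, MonoidHom.coe_coe, Function.comp_apply, delDist_of,
        lengthHom, map_add, map_smul, map_one, MonoidAlgebra.lift_of, FreeMonoid.lift_eval_of]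
      simp
  have h2 := congrArg TrivSqZeroExt.snd (DFunLike.congr_fun h1 z)
  have h3 (u : FreeMonoid Bool) :=
    freeMonoid_lift_const (1 + DualNumber.eps : DualNumber ℝ) u
  have h4 (k : ℕ) := one_add_smul_eps_pow 1 k
  simp only [one_smul, mul_one] at h4
  rw [freeMonoid_lift_const, one_add_smul_eps_pow] at h2
  simp only [MonoidHom.coe_comp, MonoidHom.coe_coe, Function.comp_apply, lengthHom,
    MonoidAlgebra.lift_apply, Finsupp.sum, h3, h4] at h2
  rw [← TrivSqZeroExt.sndHom_apply ℝ, map_sum] at h2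
  simp at h2
  rw [h2, mul_comm]

lemma coeff_mul_nonneg {μ ν : WordAlgebra} (hμ : ∀ y, 0 ≤ μ.coeff y)
    (hν : ∀ y, 0 ≤ ν.coeff y) (y : FreeMonoid Bool) : 0 ≤ (μ * ν).coeff y := by
  classical
  rw [coeff_mul]
  refine sum_nonneg fun a _ => sum_nonneg fun b _ => ?_
  dsimp only
  split_ifs
  · exact mul_nonneg (hμ a) (hν b)
  · exact le_rfl

lemma coeff_delDist_nonneg {d : ℝ} (hd : d ∈ Set.Icc (0 : ℝ) 1) (z y : FreeMonoid Bool) :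
    0 ≤ (delDist d z).coeff y := by
  classical
  induction z using FreeMonoid.inductionOn' generalizing y with
  | one => rw [map_one, one_def, coeff_single, Finsupp.single_apply]; split_ifs <;> simp
  | of_mul b z ih =>
    rw [map_mul]
    refine coeff_mul_nonneg (fun u => ?_) ih y
    simp only [coeff_delDist_of]
    refine add_nonneg ?_ ?_ <;> split_ifs <;> linarith [hd.1, hd.2]

lemma length_le_of_coeff_delDist_ne_zero (d : ℝ) (z y : FreeMonoid Bool)
    (h : (delDist d z).coeff y ≠ 0) : y.length ≤ z.length := by
  classical
  induction z using FreeMonoid.inductionOn' generalizing y with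
  | one =>
    simp only [map_one, one_def, coeff_single, Finsupp.single_apply, ne_eq,
      ite_eq_right_iff, Classical.not_imp] at h
    simp [← h.1]
  | of_mul b z ih =>
    rw [map_mul, coeff_mul] at h
    obtain ⟨u, hu, h⟩ := exists_ne_zero_of_sum_ne_zero h
    obtain ⟨v, hv, h⟩ := exists_ne_zero_of_sum_ne_zero h
    simp only [ne_eq, ite_eq_right_iff, Classical.not_imp] at h
    have hv' := ih v (Finsupp.mem_support_iff.1 hv)
    have hu' : u.length ≤ 1 := by
      rw [Finsupp.mem_support_iff] at hu
      rw [coeff_delDist_of] at hu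
      by_contra hlt
      refine hu ?_
      rw [if_neg, if_neg, add_zero]
      · rintro rfl; simp at hlt
      · rintro rfl; simp at hlt
    rw [← h.1, FreeMonoid.length_mul, FreeMonoid.length_mul, FreeMonoid.length_of]
    omega

end DeletionAlgebra

section Bridge

open MonoidAlgebra

variable {n : ℕ}

/-- A binary vector as an element of the free monoid. -/
def word (x : Fin n → Bool) : FreeMonoid Bool := FreeMonoid.ofList (List.ofFn x)

lemma length_word (x : Fin n → Bool) : (word x).length = n := List.length_ofFn

lemma word_injective : Function.Injective (word : (Fin n → Bool) → FreeMonoid Bool) :=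
  fun _ _ h => List.ofFn_injective (FreeMonoid.ofList.injective h)

lemma exists_word_eq {z : FreeMonoid Bool} (h : z.length = n) :
    ∃ x : Fin n → Bool, word x = z := by
  subst h
  exact ⟨z.toList.get, List.ofFn_get _⟩

/-- The embedding of channel outputs into words. -/
def outWord : DelOut n ↪ FreeMonoid Bool where
  toFun y := word y.2
  inj' := by
    rintro ⟨k, y⟩ ⟨k', y'⟩ h
    obtain rfl : k = k' := Fin.ext (by simpa [length_word] using congrArg FreeMonoid.length h)
    exact congrArg (Sigma.mk k) (word_injective h)

lemma outWord_restrictSub (x : Fin n → Bool) (S : Finset (Fin n)) :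
    outWord (restrictSub x S) =
      FreeMonoid.ofList (((List.finRange n).filter (· ∈ S)).map x) := by
  have h : (List.finRange n).filter (· ∈ S) = S.sort := by
    refine List.SortedLT.eq_of_mem_iff ?_ S.sortedLT_sort (by simp)
    exact ((List.sortedLT_finRange n).pairwise.filter _).sortedLT
  rw [h, ← S.listMap_orderEmbOfFin_finRange rfl, List.map_map, ← List.ofFn_eq_map]
  rfl

lemma delDist_ofList_map {ι : Type*} [DecidableEq ι] (d : ℝ) (x : ι → Bool) (l : List ι)
    (hl : l.Nodup) :
    delDist d (FreeMonoid.ofList (l.map x)) = ∑ S ∈ l.toFinset.powerset,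
      single (FreeMonoid.ofList ((l.filter (· ∈ S)).map x))
        ((1 - d) ^ S.card * d ^ (l.length - S.card)) := by
  induction l with
  | nil => simp [one_def]
  | cons i l ih =>
    obtain ⟨hi, hl⟩ := List.nodup_cons.1 hl
    have hi' : i ∉ l.toFinset := by simpa using hi
    rw [List.map_cons, FreeMonoid.ofList_cons, map_mul, ih hl, List.toFinset_cons,
      sum_powerset_insert hi', delDist_of, add_mul, smul_mul_assoc, one_mul, smul_sum,
      smul_mul_assoc, mul_sum, smul_sum]
    congr 1
    all_goals
      refine sum_congr rfl fun S hS => ?_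
      have hiS : i ∉ S := fun h => hi' (mem_powerset.1 hS h)
      have hcard : S.card ≤ l.length :=
        (card_le_card (mem_powerset.1 hS)).trans (List.toFinset_card_le l)
    · rw [smul_single, List.filter_cons_of_neg (by simpa using hiS), List.length_cons,
        Nat.succ_sub hcard, smul_eq_mul, pow_succ]
      ring_nf
    · have hfilter : l.filter (· ∈ insert i S) = l.filter (· ∈ S) := by
        refine List.filter_congr fun j hj => ?_
        have : j ≠ i := by rintro rfl; exact hi hj
        simp [this]
      rw [of_apply, single_mul_single, smul_single, List.filter_cons_of_pos (by simp), hfilter,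
        List.map_cons, FreeMonoid.ofList_cons, card_insert_of_notMem hiS, List.length_cons,
        Nat.succ_sub_succ, smul_eq_mul, pow_succ]
      ring_nf

lemma delW_eq_coeff (d : ℝ) (x : Fin n → Bool) (y : DelOut n) :
    delW d x y = (delDist d (word x)).coeff (outWord y) := by
  rw [word, List.ofFn_eq_map, delDist_ofList_map d x _ (List.nodup_finRange n), coeff_sum,
    Finsupp.finsetSum_apply, List.toFinset_finRange, powerset_univ, delW]
  refine sum_congr rfl fun S _ => ?_
  classical
  rw [coeff_single, Finsupp.single_apply, ← outWord_restrictSub, List.length_finRange]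
  simp only [outWord.injective.eq_iff]

/-- The output distribution of the deletion channel with input distribution `p`. -/
def outDist (d : ℝ) (p : (Fin n → Bool) → ℝ) : WordAlgebra := ∑ x, p x • delDist d (word x)

lemma coeff_outDist (d : ℝ) (p : (Fin n → Bool) → ℝ) (y : FreeMonoid Bool) :
    (outDist d p).coeff y = ∑ x, p x * (delDist d (word x)).coeff y := by
  simp [outDist, coeff_sum, Finsupp.finsetSum_apply]

lemma mass_outDist (d : ℝ) {p : (Fin n → Bool) → ℝ} (hp : IsDist p) :
    mass (outDist d p) = 1 := by
  simp [outDist, mass_delDist, hp.2]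

lemma mutualInfo_delW (d : ℝ) (p : (Fin n → Bool) → ℝ) :
    mutualInfo p (delW d) =
      ∑ x, p x * relEntropy (delDist d (word x)).coeff (outDist d p).coeff := by
  refine sum_congr rfl fun x _ => ?_
  rw [relEntropy, mul_sum]
  simp_rw [delW_eq_coeff, ← coeff_outDist]
  rw [← sum_map univ outWord fun y => p x * (delDist d (word x)).coeff y *
    Real.logb 2 ((delDist d (word x)).coeff y / (outDist d p).coeff y)]
  symm
  simp_rw [← mul_assoc]
  refine sum_subset (fun y hy => ?_) fun y _ hy => by simp [Finsupp.notMem_support_iff.1 hy]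
  have hlen := length_le_of_coeff_delDist_ne_zero d _ y (Finsupp.mem_support_iff.1 hy)
  rw [length_word] at hlen
  obtain ⟨v, hv⟩ := exists_word_eq (n := y.length) rfl
  exact mem_map.2 ⟨⟨⟨y.length, Nat.lt_succ_of_le hlen⟩, v⟩, mem_univ _, hv⟩

lemma coeff_outDist_nonneg {d : ℝ} (hd : d ∈ Set.Icc (0 : ℝ) 1) {p : (Fin n → Bool) → ℝ}
    (hp : ∀ x, 0 ≤ p x) (y : FreeMonoid Bool) : 0 ≤ (outDist d p).coeff y := by
  rw [coeff_outDist]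
  exact sum_nonneg fun x _ => mul_nonneg (hp x) (coeff_delDist_nonneg hd _ _)

lemma coeff_outDist_ne_zero {d : ℝ} (hd : d ∈ Set.Icc (0 : ℝ) 1) {p : (Fin n → Bool) → ℝ}
    (hp : ∀ x, 0 ≤ p x) {x : Fin n → Bool} (hx : p x ≠ 0) {y : FreeMonoid Bool}
    (hy : (delDist d (word x)).coeff y ≠ 0) : (outDist d p).coeff y ≠ 0 := by
  rw [coeff_outDist]
  refine (sum_pos' (fun x _ => mul_nonneg (hp x) (coeff_delDist_nonneg hd _ _))
    ⟨x, mem_univ _, ?_⟩).ne'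
  exact mul_pos ((hp x).lt_of_ne' hx) ((coeff_delDist_nonneg hd _ _).lt_of_ne' hy)

lemma mutualInfo_delW_nonneg {d : ℝ} (hd : d ∈ Set.Icc (0 : ℝ) 1) {p : (Fin n → Bool) → ℝ}
    (hp : IsDist p) : 0 ≤ mutualInfo p (delW d) := by
  rw [mutualInfo_delW]
  refine sum_nonneg fun x _ => ?_
  by_cases hx : p x = 0
  · simp [hx]
  refine mul_nonneg (hp.1 x) (relEntropy_nonneg _ _ (coeff_delDist_nonneg hd _)
    (coeff_outDist_nonneg hd hp.1) (fun y hy => coeff_outDist_ne_zero hd hp.1 hx hy) ?_ ?_)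
  · rw [← mass_eq_sum, mass_delDist]
  · rw [← mass_eq_sum, mass_outDist d hp]

lemma mutualInfo_delW_le {d : ℝ} (hd : d ∈ Set.Icc (0 : ℝ) 1) {p : (Fin n → Bool) → ℝ}
    (hp : IsDist p) {ν : WordAlgebra} (hν : ∀ y, 0 ≤ ν.coeff y) (hν1 : mass ν ≤ 1)
    (hac : ∀ x, p x ≠ 0 → ∀ y, (delDist d (word x)).coeff y ≠ 0 → ν.coeff y ≠ 0) :
    mutualInfo p (delW d) ≤ ∑ x, p x * relEntropy (delDist d (word x)).coeff ν.coeff := by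
  have hacq : ∀ y, (outDist d p).coeff y ≠ 0 → ν.coeff y ≠ 0 := fun y hy => by
    rw [coeff_outDist] at hy
    obtain ⟨x, -, hx⟩ := exists_ne_zero_of_sum_ne_zero hy
    exact hac x (left_ne_zero_of_mul hx) y (right_ne_zero_of_mul hx)
  have hnonneg := relEntropy_nonneg (outDist d p).coeff ν.coeff
    (coeff_outDist_nonneg hd hp.1) hν hacq (by rw [← mass_eq_sum, mass_outDist d hp])
    (by rwa [← mass_eq_sum])
  have hterm (x : Fin n → Bool) :
      p x * relEntropy (delDist d (word x)).coeff ν.coeff =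
        p x * relEntropy (delDist d (word x)).coeff (outDist d p).coeff +
        ∑ y ∈ (outDist d p).coeff.support, p x * (delDist d (word x)).coeff y *
          Real.logb 2 ((outDist d p).coeff y / ν.coeff y) := by
    by_cases hx : p x = 0
    · simp [hx]
    have hsub : (delDist d (word x)).coeff.support ⊆ (outDist d p).coeff.support := fun y hy =>
      Finsupp.mem_support_iff.2
        (coeff_outDist_ne_zero hd hp.1 hx (Finsupp.mem_support_iff.1 hy))
    rw [← sum_subset hsub fun y _ hy => by simp [Finsupp.notMem_support_iff.1 hy]]
    simp_rw [mul_assoc]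
    rw [← mul_sum, ← mul_add, relEntropy, relEntropy, ← sum_add_distrib]
    congr 1
    refine sum_congr rfl fun y hy => ?_
    have h1 := Finsupp.mem_support_iff.1 hy
    have h2 := coeff_outDist_ne_zero hd hp.1 hx h1
    have h3 := hacq y h2
    rw [Real.logb_div h1 h3, Real.logb_div h1 h2, Real.logb_div h2 h3]
    ring
  rw [mutualInfo_delW, sum_congr rfl fun x _ => hterm x, sum_add_distrib, sum_comm (s := univ)]
  simp_rw [← sum_mul, ← coeff_outDist]
  exact le_add_of_nonneg_right hnonneg

lemma bddAbove_mutualInfo {α β : Type*} [Fintype α] [Fintype β] (W : α → β → ℝ)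
    (hW : ∀ x y, 0 ≤ W x y) :
    BddAbove (Set.range fun p : {p : α → ℝ // IsDist p} => mutualInfo p.1 W) := by
  refine ⟨∑ x, ∑ y, W x y / Real.log 2, ?_⟩
  rintro _ ⟨⟨p, hp⟩, rfl⟩
  refine sum_le_sum fun x _ => sum_le_sum fun y _ => ?_
  have hlog : 0 < Real.log 2 := Real.log_pos one_lt_two
  rcases (hp.1 x).eq_or_lt with hx | hx
  · simpa [← hx] using div_nonneg (hW x y) hlog.le
  rcases (hW x y).eq_or_lt with hxy | hxy
  · simp [← hxy]
  have hle : p x * W x y ≤ ∑ x', p x' * W x' y :=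
    single_le_sum (f := fun x' => p x' * W x' y) (fun i _ => mul_nonneg (hp.1 i) (hW i y))
      (mem_univ x)
  have hq : 0 < ∑ x', p x' * W x' y := (mul_pos hx hxy).trans_le hle
  have h1 : Real.log (W x y / ∑ x', p x' * W x' y) ≤ Real.log (p x)⁻¹ := by
    refine Real.log_le_log (by positivity) ?_
    rw [div_le_iff₀ hq, inv_mul_eq_div, le_div_iff₀ hx]
    linarith
  have h2 : p x * Real.log (p x)⁻¹ ≤ 1 := by
    have h3 := mul_le_mul_of_nonneg_left (Real.one_sub_inv_le_log_of_pos hx) hx.le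
    rw [mul_sub, mul_inv_cancel₀ hx.ne'] at h3
    rw [Real.log_inv]
    linarith
  rw [Real.logb, mul_div_assoc']
  refine div_le_div_of_nonneg_right ?_ hlog.le
  calc p x * W x y * Real.log (W x y / ∑ x', p x' * W x' y)
      ≤ p x * W x y * Real.log (p x)⁻¹ := mul_le_mul_of_nonneg_left h1 (by positivity)
    _ = W x y * (p x * Real.log (p x)⁻¹) := by ring
    _ ≤ W x y := mul_le_of_le_one_right hxy.le h2

end Bridge

section Capacity

open MonoidAlgebra

/-- `c` bounds the information through the deletion channel on words of length `m`: every
finite family of weighted inputs has a reference output distribution whose mean relative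
entropy is at most `c`. -/
def InfoBound (d : ℝ) (m : ℕ) (c : ℝ) : Prop :=
  ∀ (ι : Type) (s : Finset ι) (w : ι → ℝ) (z : ι → FreeMonoid Bool), (∀ i ∈ s, 0 < w i) →
    (∀ i ∈ s, (z i).length = m) →
    ∃ ν : WordAlgebra, (∀ y, 0 ≤ ν.coeff y) ∧ mass ν ≤ 1 ∧
      (∀ i ∈ s, ∀ y, (delDist d (z i)).coeff y ≠ 0 → ν.coeff y ≠ 0) ∧
      ∑ i ∈ s, w i * relEntropy (delDist d (z i)).coeff ν.coeff ≤ (∑ i ∈ s, w i) * c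

/-- The unnormalized capacity `n · C_n(d)`. -/
def totalCap (n : ℕ) (d : ℝ) : ℝ :=
  ⨆ p : {p : (Fin n → Bool) → ℝ // IsDist p}, mutualInfo p.1 (delW d)

variable {d : ℝ} {m n : ℕ} {c c' : ℝ}

lemma InfoBound.mono (h : InfoBound d m c) (hc : c ≤ c') : InfoBound d m c' := by
  intro ι s w z hw hz
  obtain ⟨ν, h1, h2, h3, h4⟩ := h ι s w z hw hz
  exact ⟨ν, h1, h2, h3,
    h4.trans (mul_le_mul_of_nonneg_left hc (sum_nonneg fun i hi => (hw i hi).le))⟩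

lemma mutualInfo_le_totalCap (hd : d ∈ Set.Icc (0 : ℝ) 1) {p : (Fin n → Bool) → ℝ}
    (hp : IsDist p) : mutualInfo p (delW d) ≤ totalCap n d :=
  le_ciSup (bddAbove_mutualInfo (delW d) fun x y => by
    rw [delW_eq_coeff]; exact coeff_delDist_nonneg hd _ _) ⟨p, hp⟩

lemma infoBound_totalCap (hd : d ∈ Set.Icc (0 : ℝ) 1) (n : ℕ) :
    InfoBound d n (totalCap n d) := by
  classical
  intro ι s w z hw hz
  rcases s.eq_empty_or_nonempty with rfl | hs
  · exact ⟨0, by simp, by simp, by simp, by simp⟩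
  have hex : ∀ i, ∃ x : Fin n → Bool, i ∈ s → word x = z i := fun i => by
    by_cases hi : i ∈ s
    · exact (exists_word_eq (hz i hi)).imp fun x hx _ => hx
    · exact ⟨fun _ => false, fun h => absurd h hi⟩
  choose g hg using hex
  set W := ∑ i ∈ s, w i with hW
  have hWpos : 0 < W := sum_pos hw hs
  set p : (Fin n → Bool) → ℝ := fun x => (∑ i ∈ s with g i = x, w i) / W with hpdef
  have hp : IsDist p := by
    refine ⟨fun x => div_nonneg (sum_nonneg fun i hi => (hw i (mem_filter.1 hi).1).le) hWpos.le,
      ?_⟩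
    rw [hpdef, ← sum_div, sum_fiberwise, div_self hWpos.ne']
  refine ⟨outDist d p, coeff_outDist_nonneg hd hp.1, (mass_outDist d hp).le, ?_, ?_⟩
  · intro i hi y hy
    rw [← hg i hi] at hy
    refine coeff_outDist_ne_zero hd hp.1 (div_pos ?_ hWpos).ne' hy
    exact sum_pos (fun j hj => hw j (mem_filter.1 hj).1) ⟨i, by simp [hi]⟩
  · calc ∑ i ∈ s, w i * relEntropy (delDist d (z i)).coeff (outDist d p).coeff
        = ∑ x, ∑ i ∈ s with g i = x,
            w i * relEntropy (delDist d (z i)).coeff (outDist d p).coeff :=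
          (sum_fiberwise _ _ _).symm
      _ = ∑ x, W * (p x * relEntropy (delDist d (word x)).coeff (outDist d p).coeff) := by
          refine sum_congr rfl fun x _ => ?_
          rw [← mul_assoc, hpdef, mul_div_cancel₀ _ hWpos.ne', sum_mul]
          refine sum_congr rfl fun i hi => ?_
          rw [← (mem_filter.1 hi).2, hg i (mem_filter.1 hi).1]
      _ = W * mutualInfo p (delW d) := by rw [← mul_sum, mutualInfo_delW]
      _ ≤ W * totalCap n d :=
          mul_le_mul_of_nonneg_left (mutualInfo_le_totalCap hd hp) hWpos.le

lemma InfoBound.mutualInfo_le (h : InfoBound d n c) (hd : d ∈ Set.Icc (0 : ℝ) 1)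
    {p : (Fin n → Bool) → ℝ} (hp : IsDist p) : mutualInfo p (delW d) ≤ c := by
  classical
  obtain ⟨ν, h1, h2, h3, h4⟩ := h _ (univ.filter fun x => p x ≠ 0) p word
    (fun x hx => (hp.1 x).lt_of_ne' (mem_filter.1 hx).2) fun x _ => length_word x
  refine (mutualInfo_delW_le hd hp h1 h2 fun x hx => h3 x (by simp [hx])).trans ?_
  rw [sum_filter_ne_zero, hp.2, one_mul] at h4
  refine le_trans (le_of_eq ?_) h4
  symm
  refine sum_subset (subset_univ _) fun x _ hx => ?_
  have : p x = 0 := by simpa using hx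
  simp [this]

lemma InfoBound.totalCap_le (h : InfoBound d n c) (hd : d ∈ Set.Icc (0 : ℝ) 1) :
    totalCap n d ≤ c := by
  have : Nonempty {p : (Fin n → Bool) → ℝ // IsDist p} :=
    ⟨⟨Pi.single (fun _ => false) 1, fun x => by
      rw [Pi.single_apply]; split_ifs <;> simp, by simp⟩⟩
  exact ciSup_le fun p => h.mutualInfo_le hd p.2

lemma relEntropy_mul_le {μ₁ μ₂ ν₁ ν₂ : WordAlgebra} (hμ₁ : ∀ y, 0 ≤ μ₁.coeff y)
    (hμ₂ : ∀ y, 0 ≤ μ₂.coeff y) (hν₁ : ∀ y, 0 ≤ ν₁.coeff y) (hν₂ : ∀ y, 0 ≤ ν₂.coeff y)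
    (hm₁ : mass μ₁ = 1) (hm₂ : mass μ₂ = 1)
    (hac₁ : ∀ y, μ₁.coeff y ≠ 0 → ν₁.coeff y ≠ 0)
    (hac₂ : ∀ y, μ₂.coeff y ≠ 0 → ν₂.coeff y ≠ 0) :
    relEntropy (μ₁ * μ₂).coeff (ν₁ * ν₂).coeff ≤
      relEntropy μ₁.coeff ν₁.coeff + relEntropy μ₂.coeff ν₂.coeff := by
  classical
  have hprod (μ ν : WordAlgebra) (y : FreeMonoid Bool) : (μ * ν).coeff y =
      ∑ q ∈ μ.coeff.support ×ˢ ν.coeff.support with q.1 * q.2 = y,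
        μ.coeff q.1 * ν.coeff q.2 := by
    rw [coeff_mul, sum_filter, sum_product]
    rfl
  have hmem (q : FreeMonoid Bool × FreeMonoid Bool)
      (hq : q ∈ μ₁.coeff.support ×ˢ μ₂.coeff.support) :
      μ₁.coeff q.1 ≠ 0 ∧ μ₂.coeff q.2 ≠ 0 := by
    simpa only [mem_product, Finsupp.mem_support_iff] using hq
  have hpos {r s : ℝ} (hr : 0 ≤ r) (hs : 0 ≤ s) (hr0 : r ≠ 0) (hs0 : s ≠ 0) : 0 < r * s :=
    mul_pos (hr.lt_of_ne' hr0) (hs.lt_of_ne' hs0)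
  refine (relEntropy_le_sum_mul_logb (μ₁.coeff.support ×ˢ μ₂.coeff.support)
    (fun q => q.1 * q.2) (fun q => μ₁.coeff q.1 * μ₂.coeff q.2)
    (fun q => ν₁.coeff q.1 * ν₂.coeff q.2) _ _
    (fun q hq => hpos (hμ₁ _) (hμ₂ _) (hmem q hq).1 (hmem q hq).2)
    (fun q hq => hpos (hν₁ _) (hν₂ _) (hac₁ _ (hmem q hq).1) (hac₂ _ (hmem q hq).2))
    (hprod μ₁ μ₂) fun y => ?_).trans (le_of_eq ?_)
  · rw [hprod]
    refine sum_le_sum_of_subset_of_nonneg (filter_subset_filter _ ?_)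
      fun q _ _ => mul_nonneg (hν₁ _) (hν₂ _)
    exact product_subset_product
      (fun u hu => Finsupp.mem_support_iff.2 (hac₁ u (Finsupp.mem_support_iff.1 hu)))
      (fun u hu => Finsupp.mem_support_iff.2 (hac₂ u (Finsupp.mem_support_iff.1 hu)))
  · rw [mass_eq_sum] at hm₁ hm₂
    calc _ = ∑ q ∈ μ₁.coeff.support ×ˢ μ₂.coeff.support,
          ((μ₁.coeff q.1 * Real.logb 2 (μ₁.coeff q.1 / ν₁.coeff q.1)) * μ₂.coeff q.2 +
          μ₁.coeff q.1 * (μ₂.coeff q.2 * Real.logb 2 (μ₂.coeff q.2 / ν₂.coeff q.2))) := by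
          refine sum_congr rfl fun q hq => ?_
          obtain ⟨h1, h2⟩ := hmem q hq
          rw [mul_div_mul_comm, Real.logb_mul (div_ne_zero h1 (hac₁ _ h1))
            (div_ne_zero h2 (hac₂ _ h2))]
          ring
      _ = _ := by
          rw [sum_add_distrib, sum_product, sum_product]
          dsimp only
          rw [← sum_mul_sum, ← sum_mul_sum, hm₁, hm₂, mul_one, one_mul]
          rfl

lemma InfoBound.add (hd : d ∈ Set.Icc (0 : ℝ) 1) (h : InfoBound d m c)
    (h' : InfoBound d n c') : InfoBound d (m + n) (c + c') := by
  intro ι s w z hw hz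
  obtain ⟨ν₁, h1, h2, h3, h4⟩ := h ι s w (fun i => FreeMonoid.ofList ((z i).toList.take m)) hw
    fun i hi => (List.length_take).trans
      (min_eq_left ((Nat.le_add_right m n).trans_eq (hz i hi).symm))
  obtain ⟨ν₂, h1', h2', h3', h4'⟩ := h' ι s w (fun i => FreeMonoid.ofList ((z i).toList.drop m))
    hw fun i hi => (List.length_drop).trans
      ((congrArg (· - m) (hz i hi)).trans (Nat.add_sub_cancel_left m n))
  set μ₁ : ι → WordAlgebra := fun i => delDist d (FreeMonoid.ofList ((z i).toList.take m))
  set μ₂ : ι → WordAlgebra := fun i => delDist d (FreeMonoid.ofList ((z i).toList.drop m))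
  have hz' (i : ι) : delDist d (z i) = μ₁ i * μ₂ i := by
    rw [← map_mul, ← FreeMonoid.ofList_append, List.take_append_drop, FreeMonoid.ofList_toList]
  refine ⟨ν₁ * ν₂, coeff_mul_nonneg h1 h1', ?_, ?_, ?_⟩
  · rw [map_mul]
    refine mul_le_one₀ h2 ?_ h2'
    rw [mass_eq_sum]
    exact sum_nonneg fun y _ => h1' y
  · intro i hi y hy
    classical
    rw [hz', coeff_mul] at hy
    obtain ⟨u, hu, hy⟩ := exists_ne_zero_of_sum_ne_zero hy
    obtain ⟨v, hv, hy⟩ := exists_ne_zero_of_sum_ne_zero hy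
    simp only [ne_eq, ite_eq_right_iff, Classical.not_imp] at hy
    have hu' := h3 i hi u (Finsupp.mem_support_iff.1 hu)
    have hv' := h3' i hi v (Finsupp.mem_support_iff.1 hv)
    rw [coeff_mul]
    have hnn (a b : FreeMonoid Bool) :
        0 ≤ if a * b = y then ν₁.coeff a * ν₂.coeff b else 0 := by
      split_ifs
      · exact mul_nonneg (h1 a) (h1' b)
      · exact le_rfl
    refine (sum_pos' (fun a _ => sum_nonneg fun b _ => hnn a b)
      ⟨u, Finsupp.mem_support_iff.2 hu', sum_pos' (fun b _ => hnn u b)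
        ⟨v, Finsupp.mem_support_iff.2 hv', ?_⟩⟩).ne'
    rw [if_pos hy.1]
    exact mul_pos ((h1 u).lt_of_ne' hu') ((h1' v).lt_of_ne' hv')
  · rw [mul_add]
    refine le_trans ?_ (add_le_add h4 h4')
    rw [← sum_add_distrib]
    refine sum_le_sum fun i hi => ?_
    rw [← mul_add, hz']
    exact mul_le_mul_of_nonneg_left (relEntropy_mul_le (coeff_delDist_nonneg hd _)
      (coeff_delDist_nonneg hd _) h1 h1' (mass_delDist _ _) (mass_delDist _ _) (h3 i hi)
      (h3' i hi)) (hw i hi).le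

lemma InfoBound.nsmul_add (hd : d ∈ Set.Icc (0 : ℝ) 1) (h : InfoBound d n c)
    (h' : InfoBound d m c') (k : ℕ) : InfoBound d (k * n + m) (k * c + c') := by
  induction k with
  | zero => simpa using h'
  | succ k ih =>
    convert h.add hd ih using 1
    · ring
    · push_cast; ring

lemma exists_infoBound_linear (hd : d ∈ Set.Icc (0 : ℝ) 1) (hn : 1 ≤ n) :
    ∃ K : ℝ, ∀ m : ℕ, InfoBound d m (m * (totalCap n d / n) + K) := by
  refine ⟨|totalCap n d| + ∑ r ∈ range n, |totalCap r d|, fun m => ?_⟩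
  have hn' : (0 : ℝ) < n := by exact_mod_cast hn
  have hr : m % n < n := Nat.mod_lt _ hn
  have h := (infoBound_totalCap hd n).nsmul_add hd (infoBound_totalCap hd (m % n)) (m / n)
  rw [Nat.div_add_mod'] at h
  refine h.mono ?_
  have h1 : totalCap (m % n) d ≤ ∑ r ∈ range n, |totalCap r d| :=
    (le_abs_self _).trans (single_le_sum (f := fun r => |totalCap r d|)
      (fun _ _ => abs_nonneg _) (mem_range.2 hr))
  have h2 : (m : ℝ) = (m / n : ℕ) * n + (m % n : ℕ) := by
    exact_mod_cast (Nat.div_add_mod' m n).symm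
  have h3 : m * (totalCap n d / n) =
      (m / n : ℕ) * totalCap n d + ((m % n : ℕ) / (n : ℝ)) * totalCap n d := by
    field_simp
    linear_combination (totalCap n d) * h2
  have h4 : -|totalCap n d| ≤ ((m % n : ℕ) / (n : ℝ)) * totalCap n d := by
    refine neg_le_of_abs_le ?_
    rw [abs_mul, abs_of_nonneg (by positivity)]
    refine mul_le_of_le_one_left (abs_nonneg _) ?_
    rw [div_le_one hn']
    exact_mod_cast hr.le
  linarith

lemma relEntropy_delDist_comp_le {e : ℝ} (hd : d ∈ Set.Icc (0 : ℝ) 1)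
    (he : e ∈ Set.Icc (0 : ℝ) 1) (x : FreeMonoid Bool) (N : ℕ) (ν : WordAlgebra)
    (η : FreeMonoid Bool → WordAlgebra) (hη : ∀ u y, 0 ≤ (η u).coeff y)
    (hν : ∀ u, (delDist e x).coeff u ≠ 0 → ∀ y, (η u).coeff y ≤ (N + 1) * ν.coeff y)
    (hνnn : ∀ y, 0 ≤ ν.coeff y)
    (hac : ∀ u, (delDist e x).coeff u ≠ 0 → ∀ y, (delDist d u).coeff y ≠ 0 →
      (η u).coeff y ≠ 0) :
    relEntropy (delDist (1 - (1 - e) * (1 - d)) x).coeff ν.coeff ≤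
      Real.logb 2 (N + 1) + ∑ u ∈ (delDist e x).coeff.support,
        (delDist e x).coeff u * relEntropy (delDist d u).coeff (η u).coeff := by
  classical
  have hN : (0 : ℝ) < N + 1 := by positivity
  have hκ (u : FreeMonoid Bool) := coeff_delDist_nonneg he x u
  have hμ (u y : FreeMonoid Bool) := coeff_delDist_nonneg hd u y
  have hκ1 := mass_delDist e x
  rw [mass_eq_sum] at hκ1
  have hμ1 (u : FreeMonoid Bool) := mass_delDist d u
  simp only [mass_eq_sum] at hμ1
  set κ := (delDist e x).coeff with hκdef
  set T : Finset (Σ _ : FreeMonoid Bool, FreeMonoid Bool) :=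
    κ.support.sigma fun u => (delDist d u).coeff.support with hT
  have hmem (q : Σ _ : FreeMonoid Bool, FreeMonoid Bool) (hq : q ∈ T) :
      κ q.1 ≠ 0 ∧ (delDist d q.1).coeff q.2 ≠ 0 := by
    simpa only [hT, mem_sigma, Finsupp.mem_support_iff] using hq
  have hfiber (F : FreeMonoid Bool → FreeMonoid Bool → ℝ) (y : FreeMonoid Bool) :
      ∑ q ∈ T with q.2 = y, F q.1 q.2 =
        ∑ u ∈ κ.support, if (delDist d u).coeff y ≠ 0 then F u y else 0 := by
    rw [sum_filter, hT, sum_sigma]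
    refine sum_congr rfl fun u _ => ?_
    rw [sum_ite_eq']
    simp only [Finsupp.mem_support_iff]
  refine (relEntropy_le_sum_mul_logb T (fun q => q.2)
    (fun q => κ q.1 * (delDist d q.1).coeff q.2)
    (fun q => κ q.1 * ((η q.1).coeff q.2 / (N + 1))) _ _
    (fun q hq => ?_) (fun q hq => ?_) (fun y => ?_) fun y => ?_).trans (le_of_eq ?_)
  · exact mul_pos ((hκ _).lt_of_ne' (hmem q hq).1) ((hμ _ _).lt_of_ne' (hmem q hq).2)
  · exact mul_pos ((hκ _).lt_of_ne' (hmem q hq).1)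
      (div_pos ((hη _ _).lt_of_ne' (hac _ (hmem q hq).1 _ (hmem q hq).2)) hN)
  · rw [hfiber fun u y => κ u * (delDist d u).coeff y, coeff_delDist_comp]
    refine sum_congr rfl fun u _ => ?_
    split_ifs with h
    · rfl
    · rw [not_not.1 h, mul_zero]
  · rw [hfiber fun u y => κ u * ((η u).coeff y / (N + 1))]
    calc _ ≤ ∑ u ∈ κ.support, κ u * ν.coeff y := by
          refine sum_le_sum fun u hu => ?_
          split_ifs
          · refine mul_le_mul_of_nonneg_left ?_ (hκ u)
            rw [div_le_iff₀' hN]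
            exact hν u (Finsupp.mem_support_iff.1 hu) y
          · exact mul_nonneg (hκ u) (hνnn y)
      _ = ν.coeff y := by rw [← sum_mul, hκ1, one_mul]
  · rw [hT, sum_sigma]
    calc _ = ∑ u ∈ κ.support, κ u * (Real.logb 2 (N + 1) +
          relEntropy (delDist d u).coeff (η u).coeff) := by
          refine sum_congr rfl fun u hu => ?_
          have hu := Finsupp.mem_support_iff.1 hu
          have hsplit : Real.logb 2 (N + 1) = ∑ y ∈ (delDist d u).coeff.support,
              (delDist d u).coeff y * Real.logb 2 (N + 1) := by rw [← sum_mul, hμ1, one_mul]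
          rw [hsplit, relEntropy, ← sum_add_distrib, mul_sum]
          refine sum_congr rfl fun y hy => ?_
          have hy := Finsupp.mem_support_iff.1 hy
          have hy' := hac u hu y hy
          dsimp only
          rw [mul_div_mul_left _ _ hu, div_div_eq_mul_div, mul_comm _ ((N : ℝ) + 1),
            mul_div_assoc, Real.logb_mul hN.ne' (div_ne_zero hy hy')]
          ring
      _ = _ := by
          simp only [mul_add, sum_add_distrib]
          rw [← sum_mul, hκ1, one_mul]

lemma InfoBound.comp {e K : ℝ} (hd : d ∈ Set.Icc (0 : ℝ) 1) (he : e ∈ Set.Icc (0 : ℝ) 1)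
    (h : ∀ m : ℕ, InfoBound d m (m * c + K)) (N : ℕ) :
    InfoBound (1 - (1 - e) * (1 - d)) N (Real.logb 2 (N + 1) + (1 - e) * N * c + K) := by
  classical
  intro ι s w z hw hz
  have hN : (0 : ℝ) < N + 1 := by positivity
  set T : Finset (Σ _ : ι, FreeMonoid Bool) :=
    s.sigma fun i => (delDist e (z i)).coeff.support with hT
  have hmem (q : Σ _ : ι, FreeMonoid Bool) (hq : q ∈ T) :
      q.1 ∈ s ∧ (delDist e (z q.1)).coeff q.2 ≠ 0 := by
    simpa only [hT, mem_sigma, Finsupp.mem_support_iff] using hq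
  have hlen (q : Σ _ : ι, FreeMonoid Bool) (hq : q ∈ T) : q.2.length ∈ range (N + 1) := by
    have := length_le_of_coeff_delDist_ne_zero e _ _ (hmem q hq).2
    rw [hz _ (hmem q hq).1] at this
    exact mem_range.2 (Nat.lt_succ_of_le this)
  have key (m : ℕ) := h m _ (T.filter fun q => q.2.length = m)
    (fun q => w q.1 * (delDist e (z q.1)).coeff q.2) (fun q => q.2)
    (fun q hq => mul_pos (hw _ (hmem q (mem_filter.1 hq).1).1)
      ((coeff_delDist_nonneg he _ _).lt_of_ne' (hmem q (mem_filter.1 hq).1).2))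
    (fun q hq => (mem_filter.1 hq).2)
  choose η h1 h2 h3 h4 using key
  set ν : WordAlgebra := ∑ m ∈ range (N + 1), ((N : ℝ) + 1)⁻¹ • η m with hνdef
  have hν (y : FreeMonoid Bool) :
      ν.coeff y = ∑ m ∈ range (N + 1), ((N : ℝ) + 1)⁻¹ * (η m).coeff y := by
    simp [hνdef, coeff_sum, Finsupp.finsetSum_apply]
  have hνnn (y : FreeMonoid Bool) : 0 ≤ ν.coeff y := by
    rw [hν]
    exact sum_nonneg fun m _ => mul_nonneg (by positivity) (h1 m y)
  have hle (m : ℕ) (hm : m ∈ range (N + 1)) (y : FreeMonoid Bool) :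
      (η m).coeff y ≤ (N + 1) * ν.coeff y := by
    rw [hν, ← mul_sum, mul_inv_cancel_left₀ hN.ne']
    exact single_le_sum (f := fun m => (η m).coeff y) (fun m _ => h1 m y) hm
  have hac (i : ι) (hi : i ∈ s) (u : FreeMonoid Bool) (hu : (delDist e (z i)).coeff u ≠ 0) :
      u.length ∈ range (N + 1) ∧
        ∀ y, (delDist d u).coeff y ≠ 0 → (η u.length).coeff y ≠ 0 := by
    have hq : (⟨i, u⟩ : Σ _ : ι, FreeMonoid Bool) ∈ T :=
      mem_sigma.2 ⟨hi, Finsupp.mem_support_iff.2 hu⟩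
    exact ⟨hlen _ hq, h3 u.length ⟨i, u⟩ (mem_filter.2 ⟨hq, rfl⟩)⟩
  refine ⟨ν, hνnn, ?_, fun i hi y hy => ?_, ?_⟩
  · rw [hνdef, map_sum]
    calc _ ≤ ∑ m ∈ range (N + 1), ((N : ℝ) + 1)⁻¹ := by
          refine sum_le_sum fun m _ => ?_
          rw [map_smul, smul_eq_mul]
          exact mul_le_of_le_one_right (by positivity) (h2 m)
      _ = 1 := by simp [hN.ne']
  · rw [coeff_delDist_comp] at hy
    obtain ⟨u, hu, hy⟩ := exists_ne_zero_of_sum_ne_zero hy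
    obtain ⟨hm, hne⟩ := hac i hi u (Finsupp.mem_support_iff.1 hu)
    have h5 := (h1 _ y).lt_of_ne' (hne y (right_ne_zero_of_mul hy))
    exact (pos_of_mul_pos_right (h5.trans_le (hle _ hm y)) hN.le).ne'
  · calc _ ≤ ∑ i ∈ s, w i * (Real.logb 2 (N + 1) +
          ∑ u ∈ (delDist e (z i)).coeff.support, (delDist e (z i)).coeff u *
            relEntropy (delDist d u).coeff (η u.length).coeff) := by
          refine sum_le_sum fun i hi => mul_le_mul_of_nonneg_left ?_ (hw i hi).le
          exact relEntropy_delDist_comp_le hd he (z i) N ν (fun u => η u.length)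
            (fun u => h1 _) (fun u hu => hle _ (hac i hi u hu).1) hνnn
            (fun u hu => (hac i hi u hu).2)
      _ = (∑ i ∈ s, w i) * Real.logb 2 (N + 1) + ∑ q ∈ T,
          w q.1 * (delDist e (z q.1)).coeff q.2 *
            relEntropy (delDist d q.2).coeff (η q.2.length).coeff := by
          rw [hT, sum_sigma, sum_mul, ← sum_add_distrib]
          refine sum_congr rfl fun i _ => ?_
          rw [mul_add, mul_sum]
          simp only [mul_assoc]
      _ ≤ (∑ i ∈ s, w i) * Real.logb 2 (N + 1) + ∑ q ∈ T,
          w q.1 * (delDist e (z q.1)).coeff q.2 * (q.2.length * c + K) := by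
          rw [← sum_fiberwise_of_maps_to hlen, ← sum_fiberwise_of_maps_to hlen]
          refine add_le_add le_rfl (sum_le_sum fun m _ => ?_)
          calc _ = ∑ q ∈ T with q.2.length = m, w q.1 * (delDist e (z q.1)).coeff q.2 *
                relEntropy (delDist d q.2).coeff (η m).coeff :=
                sum_congr rfl fun q hq => by rw [(mem_filter.1 hq).2]
            _ ≤ _ := h4 m
            _ = _ := by
              rw [sum_mul]
              exact sum_congr rfl fun q hq => by rw [(mem_filter.1 hq).2]
      _ = (∑ i ∈ s, w i) * (Real.logb 2 (N + 1) + (1 - e) * N * c + K) := by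
          rw [hT, sum_sigma, sum_mul, sum_mul, ← sum_add_distrib]
          refine sum_congr rfl fun i hi => ?_
          have h5 := sum_delDist_mul_length e (z i)
          have h6 := mass_delDist e (z i)
          rw [mass_eq_sum] at h6
          rw [hz i hi] at h5
          calc _ = w i * Real.logb 2 (N + 1) + w i *
                ((∑ u ∈ (delDist e (z i)).coeff.support,
                  (delDist e (z i)).coeff u * (u.length : ℝ)) * c +
                (∑ u ∈ (delDist e (z i)).coeff.support, (delDist e (z i)).coeff u) * K) := by
                rw [sum_mul, sum_mul, ← sum_add_distrib, mul_sum]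
                congr 1
                exact sum_congr rfl fun u _ => by ring
            _ = _ := by rw [h5, h6]; ring

end Capacity

lemma Cn_eq (n : ℕ) (d : ℝ) : Cn n d = totalCap n d / n := by
  rw [Cn, totalCap, one_div_mul_eq_div]

lemma Cn_nonneg {d : ℝ} (hd : d ∈ Set.Icc (0 : ℝ) 1) (n : ℕ) : 0 ≤ Cn n d :=
  mul_nonneg (by positivity) (Real.iSup_nonneg fun p => mutualInfo_delW_nonneg hd p.2)

lemma C_le_Cn {d : ℝ} (hd : d ∈ Set.Icc (0 : ℝ) 1) {n : ℕ} (hn : 1 ≤ n) : C d ≤ Cn n d :=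
  ciInf_le (f := fun n : {m : ℕ // 1 ≤ m} => Cn n d)
    ⟨0, by rintro _ ⟨m, rfl⟩; exact Cn_nonneg hd m⟩ ⟨n, hn⟩

lemma tendsto_logb_succ_add_div (K : ℝ) :
    Filter.Tendsto (fun N : ℕ => (Real.logb 2 (N + 1) + K) / N) Filter.atTop (nhds 0) := by
  have hlog : (fun x : ℝ => Real.log (x + 1)) =o[Filter.atTop] fun x : ℝ => x := by
    have h := Real.isLittleO_log_id_atTop.comp_tendsto
      (Filter.tendsto_atTop_add_const_right Filter.atTop (1 : ℝ) Filter.tendsto_id)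
    refine h.trans_isBigO ?_
    refine Asymptotics.IsBigO.add (Asymptotics.isBigO_refl _ _) ?_
    exact (Asymptotics.isLittleO_const_id_atTop (1 : ℝ)).isBigO
  have h1 := (hlog.tendsto_div_nhds_zero.comp tendsto_natCast_atTop_atTop).div_const (Real.log 2)
  have h2 := tendsto_const_div_atTop_nhds_zero_nat K
  have h3 := h1.add h2
  rw [zero_div, add_zero] at h3
  refine h3.congr fun N => ?_
  simp only [Function.comp_apply, Real.logb]
  ring

lemma C_comp_le {d e : ℝ} (hd : d ∈ Set.Icc (0 : ℝ) 1) (he : e ∈ Set.Icc (0 : ℝ) 1) {n : ℕ}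
    (hn : 1 ≤ n) : C (1 - (1 - e) * (1 - d)) ≤ (1 - e) * Cn n d := by
  have hde : 1 - (1 - e) * (1 - d) ∈ Set.Icc (0 : ℝ) 1 := by
    obtain ⟨h1, h2⟩ := hd
    obtain ⟨h3, h4⟩ := he
    constructor <;> nlinarith
  obtain ⟨K, hK⟩ := exists_infoBound_linear hd hn
  have hlim := (tendsto_logb_succ_add_div K).add_const ((1 - e) * Cn n d)
  rw [zero_add] at hlim
  refine ge_of_tendsto hlim (Filter.eventually_atTop.2 ⟨1, fun N hN => ?_⟩)
  have hN' : (0 : ℝ) < N := by exact_mod_cast hN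
  refine (C_le_Cn hde hN).trans ?_
  have := (InfoBound.comp hd he hK N).totalCap_le hde
  rw [Cn_eq, div_le_iff₀ hN', Cn_eq]
  refine this.trans (le_of_eq ?_)
  field_simp
  ring

/-- For every `n ≥ 1` and every `d' ∈ (0,1)`, the limit
`lim_{d→1⁻} C(d)/(1−d)` (which exists, taken along `d` tending to `1` from the left
within `(0,1)`) is at most `C_n(d')/(1−d')`. -/
theorem C_ratio_limit_le_Cn (n : ℕ) (hn : 1 ≤ n) (d' : ℝ) (hd' : d' ∈ Set.Ioo (0 : ℝ) 1)
    (l : ℝ)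
    (hlim : Filter.Tendsto (fun d : ℝ => C d / (1 - d)) (nhdsWithin 1 (Set.Ioo 0 1))
      (nhds l)) :
    l ≤ Cn n d' / (1 - d') := by
  have hne : (nhdsWithin (1 : ℝ) (Set.Ioo 0 1)).NeBot := by
    rw [nhdsWithin_Ioo_eq_nhdsLT one_pos]
    infer_instance
  have h1 : 0 < 1 - d' := sub_pos.2 hd'.2
  refine le_of_tendsto hlim ?_
  filter_upwards [self_mem_nhdsWithin, nhdsWithin_le_nhds (Ioi_mem_nhds hd'.2)] with d hd hdd
  have h2 : 0 < 1 - d := sub_pos.2 hd.2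
  have he : 1 - (1 - d) / (1 - d') ∈ Set.Icc (0 : ℝ) 1 := by
    refine ⟨?_, sub_le_self _ (by positivity)⟩
    rw [sub_nonneg, div_le_one h1]
    linarith [Set.mem_Ioi.1 hdd]
  have h := C_comp_le ⟨hd'.1.le, hd'.2.le⟩ he hn
  rw [sub_sub_cancel, div_mul_cancel₀ _ h1.ne', sub_sub_cancel] at h
  rw [div_le_iff₀ h2]
  exact h.trans (le_of_eq (by ring))
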